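/- If R is a commutative coefficient ring in which λ_1! · λ_2! · ... · λ_n! is a unit, then for every degree d there is an isomorphism H̃_d(M_N; R) ≅ H̃_d(BD_n^λ; R) ⊕ H_d(C̃(M_N; R)^{S_λ}), where C̃(M_N; R)^{S_λ} is the subcomplex of the reduced simplicial chain complex of M_N over R generated by the elements c − g(c) for g ∈ S_λ. -/

import Mathlib

set_option synthInstance.maxHeartbeats 1000000
set_option maxHeartbeats 1000000

noncomputable section

namespace MatchPaper

attribute [local instance 10] Classical.propDecidable

/-! ### Guarded constructions on additive groups -/

section AddGadgets

variable {A B : Type*} [AddCommGroup A] [AddCommGroup B]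

/-- Lift a homomorphism to the quotient (it genuinely descends whenever it kills `S`). -/
def liftOrZero (S : AddSubgroup A) (f : A →+ B) : A ⧸ S →+ B :=
  if h : S ≤ f.ker then QuotientAddGroup.lift S f h else 0

/-- Descend a homomorphism to quotients (genuine whenever `f S ≤ T`). -/
def descend (S : AddSubgroup A) (T : AddSubgroup B) (f : A →+ B) : A ⧸ S →+ B ⧸ T :=
  if h : S ≤ T.comap f then QuotientAddGroup.map S T f h else 0

/-- Restrict a homomorphism to subgroups (genuine whenever `f Z ≤ Z'`). -/
def restrictHom (f : A →+ B) (Z : AddSubgroup A) (Z' : AddSubgroup B) : Z →+ Z' :=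
  if h : ∀ x : Z, f x ∈ Z' then (f.comp Z.subtype).codRestrict Z' (fun x => h x) else 0

/-- The subquotient `Z / (Bd ∩ Z)`. -/
abbrev subQuot (Z Bd : AddSubgroup A) : Type _ := Z ⧸ Bd.addSubgroupOf Z

/-- The map induced by `f` on subquotients. -/
def subQuotMap (f : A →+ B) (Z Bd : AddSubgroup A) (Z' Bd' : AddSubgroup B) :
    subQuot Z Bd →+ subQuot Z' Bd' :=
  descend (Bd.addSubgroupOf Z) (Bd'.addSubgroupOf Z') (restrictHom f Z Z')

end AddGadgets

/-! ### Chain complexes of abelian groups, group actions, quotient and fixed-difference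
subcomplexes, and homology -/

section Abstract

variable (X : ℤ → Type*) [∀ i, AddCommGroup (X i)]

/-- Transport along an equality of indices. -/
def castAE {i j : ℤ} (h : i = j) : X i ≃+ X j := by subst h; exact AddEquiv.refl _

variable (d : ∀ i : ℤ, X (i + 1) →+ X i)

/-- The boundary map leaving degree `i`. -/
def dfrom (i : ℤ) : X i →+ X (i - 1) :=
  (d (i - 1)).comp (castAE X (show i = (i - 1) + 1 by ring)).toAddMonoidHom

/-- Cycles in degree `i`. -/
def cyc (i : ℤ) : AddSubgroup (X i) := (dfrom X d i).ker

/-- Boundaries in degree `i`. -/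
def bdr (i : ℤ) : AddSubgroup (X i) := (d i).range

/-- Homology of the chain complex `(X, d)` in degree `i`. -/
abbrev Hgrp (i : ℤ) : Type _ := subQuot (cyc X d i) (bdr X d i)

variable {G : Type*} [Group G] (act : G → ∀ i : ℤ, X i ≃+ X i)

/-- The subgroup `C_i^G` generated by the elements `c - g c`. -/
def gsub (i : ℤ) : AddSubgroup (X i) :=
  AddSubgroup.closure {x | ∃ (c : X i) (g : G), x = c - act g i c}

/-- The degree-`i` part of the quotient complex `C/G`. -/
abbrev QX (i : ℤ) : Type _ := X i ⧸ gsub X act i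

/-- The boundary map of the quotient complex `C/G`. -/
def qd (i : ℤ) : QX X act (i + 1) →+ QX X act i :=
  descend (gsub X act (i + 1)) (gsub X act i) (d i)

/-- Homology of the quotient complex `C/G`. -/
abbrev HQgrp (i : ℤ) : Type _ := Hgrp (QX X act) (qd X d act) i

/-- The boundary map of the subcomplex `C^G`. -/
def sd (i : ℤ) : gsub X act (i + 1) →+ gsub X act i :=
  restrictHom (d i) (gsub X act (i + 1)) (gsub X act i)

/-- Homology of the subcomplex `C^G`. -/
abbrev HSgrp (i : ℤ) : Type _ := Hgrp (fun j => gsub X act j) (sd X d act) i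

/-- The projection chain map `C → C/G`. -/
def projX (i : ℤ) : X i →+ QX X act i := QuotientAddGroup.mk' _

/-- The map `π*` induced on homology by the projection `C → C/G`. -/
def piStar (i : ℤ) : Hgrp X d i →+ HQgrp X d act i :=
  subQuotMap (projX X act i) (cyc X d i) (bdr X d i)
    (cyc (QX X act) (qd X d act) i) (bdr (QX X act) (qd X d act) i)

/-- The chain map `φ : C/G → C`, `[c] ↦ ∑ g • c`. -/
def phiX [Fintype G] (i : ℤ) : QX X act i →+ X i :=
  liftOrZero (gsub X act i) (∑ g : G, (act g i).toAddMonoidHom)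

/-- The map `φ*` induced on homology by `φ`. -/
def phiStar [Fintype G] (i : ℤ) : HQgrp X d act i →+ Hgrp X d i :=
  subQuotMap (phiX X act i) (cyc (QX X act) (qd X d act) i) (bdr (QX X act) (qd X d act) i)
    (cyc X d i) (bdr X d i)

end Abstract

/-! ### Guarded constructions on modules -/

section LinGadgets

variable (R : Type*) [CommRing R] {M N : Type*} [AddCommGroup M] [Module R M]
  [AddCommGroup N] [Module R N]

def liftOrZeroL (S : Submodule R M) (f : M →ₗ[R] N) : (M ⧸ S) →ₗ[R] N :=
  if h : S ≤ LinearMap.ker f then S.liftQ f h else 0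

def descendL (S : Submodule R M) (T : Submodule R N) (f : M →ₗ[R] N) :
    (M ⧸ S) →ₗ[R] (N ⧸ T) :=
  if h : S ≤ T.comap f then S.mapQ T f h else 0

def restrictL (f : M →ₗ[R] N) (Z : Submodule R M) (Z' : Submodule R N) : Z →ₗ[R] Z' :=
  if h : ∀ x ∈ Z, f x ∈ Z' then f.restrict h else 0

/-- The subquotient `Z / (Bd ∩ Z)`. -/
abbrev subQuotL (Z Bd : Submodule R M) : Type _ := Z ⧸ Bd.comap Z.subtype

def subQuotMapL (f : M →ₗ[R] N) (Z Bd : Submodule R M) (Z' Bd' : Submodule R N) :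
    subQuotL R Z Bd →ₗ[R] subQuotL R Z' Bd' :=
  descendL R (Bd.comap Z.subtype) (Bd'.comap Z'.subtype) (restrictL R f Z Z')

end LinGadgets

/-! ### Reduced simplicial chains and homology of a family of finite sets

A family `K : Finset V → Prop` of finite subsets of a vertex type `V` (in our applications a
simplicial complex, in particular closed under taking subsets and containing `∅`) has reduced
simplicial chain groups over a ring `R`: the degree-`d` chain group is free on the faces of
cardinality `d + 1`, i.e. we index chain groups by the cardinality `c = d + 1` of the faces,
with the empty face (cardinality `0`, degree `-1`) giving the augmentation.  Orientations are
induced by an injection `rank : V → ℕ` of the vertices into `ℕ`. -/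

section Simplicial

variable (R : Type*) [CommRing R]

/-- Chains on the faces of cardinality `c` of the family `K`. -/
abbrev SChain {V : Type*} (K : Finset V → Prop) (c : ℕ) : Type _ :=
  {σ : Finset V // K σ ∧ σ.card = c} →₀ R

/-- The basis chain of a face, or zero for a non-face. -/
def basisOrZero {V : Type*} (K : Finset V → Prop) (c : ℕ) (τ : Finset V) : SChain R K c :=
  if h : K τ ∧ τ.card = c then Finsupp.single ⟨τ, h⟩ (1 : R) else 0

/-- The simplicial boundary map, with signs determined by the ordering of the vertices via
`rank`. -/
def bdry {V : Type*} [DecidableEq V] (rank : V → ℕ) (K : Finset V → Prop) (c : ℕ) :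
    SChain R K (c + 1) →ₗ[R] SChain R K c :=
  Finsupp.lsum R fun σ => LinearMap.toSpanSingleton R _
    (∑ v ∈ σ.1, ((-1 : ℤ) ^ ((σ.1.filter fun u => rank u < rank v).card) •
      basisOrZero R K c (σ.1.erase v)))

/-- The orientation sign of a map `f` on a face `σ`: the parity of the number of inversions. -/
def mapSign {V W : Type*} (rank : V → ℕ) (rank' : W → ℕ) (f : V → W) (σ : Finset V) : ℤ :=
  (-1) ^ (((σ ×ˢ σ).filter fun p => rank p.1 < rank p.2 ∧ rank' (f p.2) < rank' (f p.1)).card)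

/-- The chain map induced by a map `f` on vertices, taking orientations into account. -/
def chainMap {V W : Type*} [DecidableEq V] [DecidableEq W] (rank : V → ℕ) (rank' : W → ℕ)
    (f : V → W) (K : Finset V → Prop) (K' : Finset W → Prop) (c : ℕ) :
    SChain R K c →ₗ[R] SChain R K' c :=
  Finsupp.lsum R fun σ => LinearMap.toSpanSingleton R _
    (mapSign rank rank' f σ.1 • basisOrZero R K' c (σ.1.image f))

/-- Cycles among the chains on faces of cardinality `c` (for `c = 0` everything is a cycle:
the boundary map leaving degree `-1` is zero). -/
def cycLow {V : Type*} [DecidableEq V] (rank : V → ℕ) (K : Finset V → Prop) :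
    (c : ℕ) → Submodule R (SChain R K c)
  | 0 => ⊤
  | (m + 1) => LinearMap.ker (bdry R rank K m)

/-- Reduced simplicial homology at the faces of cardinality `c`, i.e. in degree `c - 1`. -/
abbrev RHc {V : Type*} [DecidableEq V] (rank : V → ℕ) (K : Finset V → Prop) (c : ℕ) : Type _ :=
  subQuotL R (cycLow R rank K c) (LinearMap.range (bdry R rank K c))

/-- Reduced simplicial homology `H̃_dg(K; R)`. -/
abbrev RH {V : Type*} [DecidableEq V] (rank : V → ℕ) (K : Finset V → Prop) (dg : ℕ) : Type _ :=
  RHc R rank K (dg + 1)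

end Simplicial

/-! ### The matching complex and the complexes of graphs of bounded degree -/

/-- The standard injection of pairs into `ℕ`, inducing the lexicographic order. -/
def rankP (m : ℕ) : Fin m × Fin m → ℕ := fun p => p.1.val * m + p.2.val

/-- A face of the matching complex `M_m`: a set of edges `(i, j)`, `i < j`, of the complete
graph on `Fin m`, no two of which share an endpoint. -/
def IsMatching (m : ℕ) (σ : Finset (Fin m × Fin m)) : Prop :=
  (∀ p ∈ σ, p.1 < p.2) ∧
    ∀ p ∈ σ, ∀ q ∈ σ, p ≠ q → p.1 ≠ q.1 ∧ p.1 ≠ q.2 ∧ p.2 ≠ q.1 ∧ p.2 ≠ q.2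

/-- `H̃_dg(M_m; R)`, the reduced homology of the matching complex on `m` vertices. -/
abbrev MH (R : Type*) [CommRing R] (m dg : ℕ) : Type _ := RH R (rankP m) (IsMatching m) dg

/-- The degree of the vertex `i` in the graph `σ` (a loop `(i, i)` counts twice). -/
def degB {n : ℕ} (σ : Finset (Fin n × Fin n)) (i : Fin n) : ℕ :=
  ∑ p ∈ σ, ((if p.1 = i then 1 else 0) + (if p.2 = i then 1 else 0))

/-- A face of `BD_n^λ`: a graph on `Fin n` (loops allowed, encoded as pairs `(i, j)` with
`i ≤ j`) in which the vertex `i` has degree at most `λ i`. -/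
def IsBDGraph {n : ℕ} (lam : Fin n → ℕ) (σ : Finset (Fin n × Fin n)) : Prop :=
  (∀ p ∈ σ, p.1 ≤ p.2) ∧ ∀ i, degB σ i ≤ lam i

/-- `H̃_dg(BD_n^λ; R)`. -/
abbrev BDH (R : Type*) [CommRing R] {n : ℕ} (lam : Fin n → ℕ) (dg : ℕ) : Type _ :=
  RH R (rankP n) (IsBDGraph lam) dg

/-! ### The Young group action on the matching complex -/

/-- The action of a permutation of the vertices on the edges of the complete graph. -/
def emap {m : ℕ} (g : Equiv.Perm (Fin m)) : Fin m × Fin m → Fin m × Fin m :=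
  fun p => (min (g p.1) (g p.2), max (g p.1) (g p.2))

/-- The quotient map on edges induced by a surjection `kap` on vertices (whose fibers are the
blocks `U_i` of the partition). -/
def kmap {N n : ℕ} (kap : Fin N → Fin n) : Fin N × Fin N → Fin n × Fin n :=
  fun p => (min (kap p.1) (kap p.2), max (kap p.1) (kap p.2))

/-- Membership of a permutation in the Young group: it preserves each block of the partition
determined by `kap`. -/
def KeepsBlocks {N n : ℕ} (kap : Fin N → Fin n) (g : Equiv.Perm (Fin N)) : Prop :=
  ∀ x, kap (g x) = kap x

section YoungAction

variable (R : Type*) [CommRing R]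

/-- The action of a permutation `g` of the `N` vertices on chains. -/
def actC (N : ℕ) (K : Finset (Fin N × Fin N) → Prop) (g : Equiv.Perm (Fin N)) (c : ℕ) :
    SChain R K c →ₗ[R] SChain R K c :=
  chainMap R (rankP N) (rankP N) (emap g) K K c

/-- The submodule of chains generated by the elements `c - g c`, `g` in the Young group. -/
def ysub (N n : ℕ) (kap : Fin N → Fin n) (K : Finset (Fin N × Fin N) → Prop) (c : ℕ) :
    Submodule R (SChain R K c) :=
  Submodule.span R {x | ∃ (ch : SChain R K c) (g : Equiv.Perm (Fin N)),
    KeepsBlocks kap g ∧ x = ch - actC R N K g c ch}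

/-- The chains of the quotient complex `C̃/S_λ`. -/
abbrev QC (N n : ℕ) (kap : Fin N → Fin n) (K : Finset (Fin N × Fin N) → Prop) (c : ℕ) :
    Type _ :=
  SChain R K c ⧸ ysub R N n kap K c

/-- The boundary map of the quotient complex `C̃/S_λ`. -/
def qbdry (N n : ℕ) (kap : Fin N → Fin n) (K : Finset (Fin N × Fin N) → Prop) (c : ℕ) :
    QC R N n kap K (c + 1) →ₗ[R] QC R N n kap K c :=
  descendL R (ysub R N n kap K (c + 1)) (ysub R N n kap K c) (bdry R (rankP N) K c)

/-- Homology of the quotient complex `C̃(M_N)/S_λ` in degree `dg`. -/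
abbrev QMH (N n : ℕ) (kap : Fin N → Fin n) (dg : ℕ) : Type _ :=
  subQuotL R (LinearMap.ker (qbdry R N n kap (IsMatching N) dg))
    (LinearMap.range (qbdry R N n kap (IsMatching N) (dg + 1)))

/-- The chain map `φ : C̃/S_λ → C̃`, `[c] ↦ ∑_{g ∈ S_λ} g c`. -/
def phiC (N n : ℕ) (kap : Fin N → Fin n) (K : Finset (Fin N × Fin N) → Prop) (c : ℕ) :
    QC R N n kap K c →ₗ[R] SChain R K c :=
  liftOrZeroL R (ysub R N n kap K c)
    (∑ g ∈ Finset.univ.filter (fun g : Equiv.Perm (Fin N) => ∀ x, kap (g x) = kap x),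
      actC R N K g c)

/-- The map `φ* : H_dg(C̃(M_N)/S_λ) → H̃_dg(M_N; R)` induced by `φ`. -/
def phiStarM (N n : ℕ) (kap : Fin N → Fin n) (dg : ℕ) :
    QMH R N n kap dg →ₗ[R] MH R N dg :=
  subQuotMapL R (phiC R N n kap (IsMatching N) (dg + 1))
    (LinearMap.ker (qbdry R N n kap (IsMatching N) dg))
    (LinearMap.range (qbdry R N n kap (IsMatching N) (dg + 1)))
    (cycLow R (rankP N) (IsMatching N) (dg + 1))
    (LinearMap.range (bdry R (rankP N) (IsMatching N) (dg + 1)))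

end YoungAction

/-! ### The subfamilies `Δ_λ` and `Γ_λ` of the matching complex -/

/-- `σ` contains two distinct edges `ab`, `cd` with `a, c` in the same block and `b, d` in the
same block. -/
def InDelta {N n : ℕ} (kap : Fin N → Fin n) (σ : Finset (Fin N × Fin N)) : Prop :=
  ∃ p ∈ σ, ∃ q ∈ σ, p ≠ q ∧
    ((kap p.1 = kap q.1 ∧ kap p.2 = kap q.2) ∨ (kap p.1 = kap q.2 ∧ kap p.2 = kap q.1))

/-- A face of `Δ_λ`. -/
def IsDelta {N n : ℕ} (kap : Fin N → Fin n) (σ : Finset (Fin N × Fin N)) : Prop :=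
  IsMatching N σ ∧ InDelta kap σ

/-- A face of `Γ_λ = M_N \ Δ_λ`. -/
def IsGamma {N n : ℕ} (kap : Fin N → Fin n) (σ : Finset (Fin N × Fin N)) : Prop :=
  IsMatching N σ ∧ ¬ InDelta kap σ

section YoungMore

variable (R : Type*) [CommRing R]

/-- The map `κ̂ : C̃(Γ_λ)/S_λ → C̃(BD_n^λ)`, `[c] ↦ κ(c)`. -/
def khat (N n : ℕ) (kap : Fin N → Fin n) (lam : Fin n → ℕ) (c : ℕ) :
    QC R N n kap (IsGamma kap) c →ₗ[R] SChain R (IsBDGraph lam) c :=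
  liftOrZeroL R (ysub R N n kap (IsGamma kap) c)
    (chainMap R (rankP N) (rankP n) (kmap kap) (IsGamma kap) (IsBDGraph lam) c)

/-- The boundary map of the subcomplex `C̃(M_N; R)^{S_λ}`. -/
def sbdry (N n : ℕ) (kap : Fin N → Fin n) (c : ℕ) :
    ysub R N n kap (IsMatching N) (c + 1) →ₗ[R] ysub R N n kap (IsMatching N) c :=
  restrictL R (bdry R (rankP N) (IsMatching N) c)
    (ysub R N n kap (IsMatching N) (c + 1)) (ysub R N n kap (IsMatching N) c)

/-- Homology of the subcomplex `C̃(M_N; R)^{S_λ}` in degree `dg`: the cycles of the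
subcomplex (elements of the subcomplex with vanishing boundary) modulo the boundaries of
elements of the subcomplex. -/
abbrev SubH (N n : ℕ) (kap : Fin N → Fin n) (dg : ℕ) : Type _ :=
  subQuotL R
    (ysub R N n kap (IsMatching N) (dg + 1) ⊓ cycLow R (rankP N) (IsMatching N) (dg + 1))
    ((ysub R N n kap (IsMatching N) (dg + 1 + 1)).map (bdry R (rankP N) (IsMatching N) (dg + 1)))

/-! ### Inclusion maps between matching complexes -/

/-- The chain map induced by the inclusion `M_m ⊆ M_{m'}`. -/
def inclChain (m m' : ℕ) (h : m ≤ m') (c : ℕ) :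
    SChain R (IsMatching m) c →ₗ[R] SChain R (IsMatching m') c :=
  chainMap R (rankP m) (rankP m') (fun p => (Fin.castLE h p.1, Fin.castLE h p.2))
    (IsMatching m) (IsMatching m') c

/-- The map `H̃_dg(M_m; R) → H̃_dg(M_{m'}; R)` induced by the inclusion. -/
def inclStar (m m' : ℕ) (h : m ≤ m') (dg : ℕ) : MH R m dg →ₗ[R] MH R m' dg :=
  subQuotMapL R (inclChain R m m' h (dg + 1))
    (cycLow R (rankP m) (IsMatching m) (dg + 1))
    (LinearMap.range (bdry R (rankP m) (IsMatching m) (dg + 1)))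
    (cycLow R (rankP m') (IsMatching m') (dg + 1))
    (LinearMap.range (bdry R (rankP m') (IsMatching m') (dg + 1)))

/-! ### The pair `(M_m, M_m \ e)`, where `e` is the last edge -/

/-- The edge `e` between the last two of the `m` vertices. -/
def eEdge (m : ℕ) (h : 2 ≤ m) : Fin m × Fin m := (⟨m - 2, by omega⟩, ⟨m - 1, by omega⟩)

/-- A face of `M_m \ e`: a matching not containing the edge `e`. -/
def MnMinusE (m : ℕ) (h : 2 ≤ m) (σ : Finset (Fin m × Fin m)) : Prop :=
  IsMatching m σ ∧ eEdge m h ∉ σ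

/-- Pass from a set of edges avoiding the last two vertices of `Fin m` to a set of edges on
`Fin (m - 2)`. -/
def shrink (m : ℕ) (σ : Finset (Fin m × Fin m)) : Finset (Fin (m - 2) × Fin (m - 2)) :=
  (σ.filter fun p => p.1.val < m - 2 ∧ p.2.val < m - 2).attach.image
    fun p => (⟨p.1.1.val, (Finset.mem_filter.mp p.2).2.1⟩,
              ⟨p.1.2.val, (Finset.mem_filter.mp p.2).2.2⟩)

/-- The chain map realizing the composition
`C̃(M_m) → C̃(M_m, M_m \ e) ≅ C̃(M_{m - 2})[1]`: a face `σ` containing `e` is written as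
`σ = ± e ∧ w` and sent to `± w`, viewed in the matching complex on the remaining `m - 2`
vertices; a face not containing `e` is sent to zero. -/
def theta (m : ℕ) (hm : 2 ≤ m) (c : ℕ) :
    SChain R (IsMatching m) (c + 1) →ₗ[R] SChain R (IsMatching (m - 2)) c :=
  Finsupp.lsum R fun σ => LinearMap.toSpanSingleton R _
    (if eEdge m hm ∈ σ.1 then
      ((-1 : ℤ) ^ c) • basisOrZero R (IsMatching (m - 2)) c (shrink m (σ.1.erase (eEdge m hm)))
     else 0)

/-- The map `H̃_dg(M_m \ e; R) → H̃_dg(M_m; R)` induced by the inclusion. -/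
def inclEStar (m : ℕ) (hm : 2 ≤ m) (dg : ℕ) :
    RH R (rankP m) (MnMinusE m hm) dg →ₗ[R] MH R m dg :=
  subQuotMapL R (chainMap R (rankP m) (rankP m) id (MnMinusE m hm) (IsMatching m) (dg + 1))
    (cycLow R (rankP m) (MnMinusE m hm) (dg + 1))
    (LinearMap.range (bdry R (rankP m) (MnMinusE m hm) (dg + 1)))
    (cycLow R (rankP m) (IsMatching m) (dg + 1))
    (LinearMap.range (bdry R (rankP m) (IsMatching m) (dg + 1)))

/-- The composition `H̃_dg(M_m; R) → H_dg(M_m, M_m \ e; R) ≅ H̃_{dg - 1}(M_{m - 2}; R)` of the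
map to relative homology with the canonical isomorphism. -/
def thetaStar (m : ℕ) (hm : 2 ≤ m) (dg : ℕ) :
    MH R m dg →ₗ[R] RHc R (rankP (m - 2)) (IsMatching (m - 2)) dg :=
  subQuotMapL R (theta R m hm dg)
    (cycLow R (rankP m) (IsMatching m) (dg + 1))
    (LinearMap.range (bdry R (rankP m) (IsMatching m) (dg + 1)))
    (cycLow R (rankP (m - 2)) (IsMatching (m - 2)) dg)
    (LinearMap.range (bdry R (rankP (m - 2)) (IsMatching (m - 2)) dg))

end YoungMore

end MatchPaper

end
namespace MatchPaper

section Signs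

variable {V W X : Type*}

/-- Contribution of an ordered pair to the orientation sign. -/
def inv1 (r : V → ℕ) (r' : W → ℕ) (f : V → W) (u v : V) : ℤ :=
  if r u < r v ∧ r' (f v) < r' (f u) then -1 else 1

/-- Contribution of an unordered pair to the orientation sign. -/
def inv2 (r : V → ℕ) (r' : W → ℕ) (f : V → W) (u v : V) : ℤ :=
  inv1 r r' f u v * inv1 r r' f v u

theorem mapSign_eq_prod (r : V → ℕ) (r' : W → ℕ) (f : V → W) (σ : Finset V) :
    mapSign r r' f σ = ∏ u ∈ σ, ∏ v ∈ σ, inv1 r r' f u v := by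
  unfold mapSign
  rw [← Finset.prod_product']
  simp only [inv1]
  rw [Finset.prod_ite]
  simp

theorem mapSign_insert [DecidableEq V] (r : V → ℕ) (r' : W → ℕ) (f : V → W) (σ : Finset V)
    (a : V) (ha : a ∉ σ) :
    mapSign r r' f (insert a σ) = mapSign r r' f σ * ∏ v ∈ σ, inv2 r r' f a v := by
  rw [mapSign_eq_prod, mapSign_eq_prod, Finset.prod_insert ha]
  simp only [Finset.prod_insert ha, Finset.prod_mul_distrib, inv2]
  have : inv1 r r' f a a = 1 := by simp [inv1]
  rw [this]
  ring

theorem mapSign_empty (r : V → ℕ) (r' : W → ℕ) (f : V → W) :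
    mapSign r r' f ∅ = 1 := by
  simp [mapSign]

theorem mapSign_sq (r : V → ℕ) (r' : W → ℕ) (f : V → W) (σ : Finset V) :
    mapSign r r' f σ * mapSign r r' f σ = 1 := by
  unfold mapSign
  rw [← pow_add, ← two_mul, pow_mul]
  simp

theorem inv2_comp (r : V → ℕ) (r' : W → ℕ) (r'' : X → ℕ) (f : V → W) (f' : W → X) (u v : V)
    (h1 : r u ≠ r v) (h2 : r' (f u) ≠ r' (f v)) (h3 : r'' (f' (f u)) ≠ r'' (f' (f v))) :
    inv2 r r'' (f' ∘ f) u v = inv2 r r' f u v * inv2 r' r'' f' (f u) (f v) := by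
  simp only [inv2, inv1, Function.comp]
  split_ifs <;> first | omega | norm_num

theorem mapSign_comp [DecidableEq V] [DecidableEq W] (r : V → ℕ) (r' : W → ℕ) (r'' : X → ℕ)
    (hr : Function.Injective r) (hr' : Function.Injective r') (hr'' : Function.Injective r'')
    (f : V → W) (f' : W → X) (σ : Finset V) (h : Set.InjOn (f' ∘ f) (σ : Set V)) :
    mapSign r r'' (f' ∘ f) σ = mapSign r r' f σ * mapSign r' r'' f' (σ.image f) := by
  induction σ using Finset.induction_on with
  | empty => simp [mapSign_empty]
  | insert a s ha ih =>
    have hs : Set.InjOn (f' ∘ f) (s : Set V) := h.mono (by simp)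
    have hne : ∀ v ∈ s, f' (f a) ≠ f' (f v) := by
      intro v hv e
      have := h (by simp) (by simp [hv]) (show (f' ∘ f) a = (f' ∘ f) v from e)
      exact ha (this ▸ hv)
    have hfa : f a ∉ s.image f := by
      intro hm
      obtain ⟨v, hv, e⟩ := Finset.mem_image.1 hm
      exact hne v hv (by rw [e])
    have hfi : Set.InjOn f (s : Set V) := fun x hx y hy e =>
      hs hx hy (by simp [Function.comp, e])
    rw [Finset.image_insert, mapSign_insert _ _ _ _ _ ha, mapSign_insert _ _ _ _ _ ha,
      mapSign_insert _ _ _ _ _ hfa, ih hs, Finset.prod_image hfi]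
    have : ∏ v ∈ s, inv2 r r'' (f' ∘ f) a v
        = (∏ v ∈ s, inv2 r r' f a v) * ∏ v ∈ s, inv2 r' r'' f' (f a) (f v) := by
      rw [← Finset.prod_mul_distrib]
      refine Finset.prod_congr rfl fun v hv => inv2_comp _ _ _ _ _ _ _ ?_ ?_ ?_
      · exact fun e => ha (hr e ▸ hv)
      · exact fun e => hne v hv (by rw [hr' e])
      · exact fun e => hne v hv (hr'' e)
    rw [this]
    ring

theorem mapSign_fix [DecidableEq V] (r : V → ℕ) (f : V → V) (ρ : Finset V)
    (h : ∀ u ∈ ρ, f u = u) : mapSign r r f ρ = 1 := by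
  rw [mapSign_eq_prod]
  refine Finset.prod_eq_one fun u hu => Finset.prod_eq_one fun v hv => ?_
  rw [inv1, h u hu, h v hv, if_neg (by omega)]

theorem mapSign_swap [DecidableEq V] (r : V → ℕ) (hr : Function.Injective r) (f : V → V)
    (σ : Finset V) (p q : V) (hp : p ∈ σ) (hq : q ∈ σ) (hpq : p ≠ q) (fp : f p = q)
    (fq : f q = p) (h : ∀ u ∈ σ, u ≠ p → u ≠ q → f u = u) : mapSign r r f σ = -1 := by
  have e : σ = insert p (insert q ((σ.erase p).erase q)) := by
    rw [Finset.insert_erase (by simp [hq, hpq.symm]), Finset.insert_erase hp]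
  have hρ : ∀ u ∈ (σ.erase p).erase q, f u = u ∧ u ≠ p ∧ u ≠ q := by
    intro u hu
    simp only [Finset.mem_erase] at hu
    exact ⟨h u hu.2.2 hu.2.1 hu.1, hu.2.1, hu.1⟩
  rw [e, mapSign_insert _ _ _ _ _ (by simp [hpq]), mapSign_insert _ _ _ _ _ (by simp),
    Finset.prod_insert (by simp), mapSign_fix _ _ _ (fun u hu => (hρ u hu).1)]
  have h1 : inv2 r r f p q = -1 := by
    have := hr.ne hpq
    simp only [inv2, inv1, fp, fq]
    split_ifs <;> first | omega | norm_num
  have h2 : (∏ v ∈ (σ.erase p).erase q, inv2 r r f q v) *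
      ∏ v ∈ (σ.erase p).erase q, inv2 r r f p v = 1 := by
    rw [← Finset.prod_mul_distrib]
    refine Finset.prod_eq_one fun u hu => ?_
    obtain ⟨a, b, c⟩ := hρ u hu
    have := hr.ne b
    have := hr.ne c
    simp only [inv2, inv1, fp, fq, a]
    split_ifs <;> first | omega | norm_num
  rw [h1]
  linear_combination (-1) * h2

end Signs

section Chain

variable (R : Type*) [CommRing R] {V W X : Type*} [DecidableEq V] [DecidableEq W] [DecidableEq X]

theorem basisOrZero_pos (K : Finset V → Prop) (c : ℕ) (τ : Finset V) (h : K τ ∧ τ.card = c) :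
    basisOrZero R K c τ = Finsupp.single ⟨τ, h⟩ (1 : R) := by
  unfold basisOrZero
  rw [dif_pos h]

theorem basisOrZero_neg (K : Finset V → Prop) (c : ℕ) (τ : Finset V) (h : ¬ (K τ ∧ τ.card = c)) :
    basisOrZero R K c τ = 0 := by
  unfold basisOrZero
  rw [dif_neg h]

theorem chainMap_basis (r : V → ℕ) (r' : W → ℕ) (f : V → W) (K : Finset V → Prop)
    (K' : Finset W → Prop) (c : ℕ) (σ : Finset V) (h : K σ ∧ σ.card = c) :
    chainMap R r r' f K K' c (basisOrZero R K c σ)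
      = mapSign r r' f σ • basisOrZero R K' c (σ.image f) := by
  rw [basisOrZero_pos R K c σ h]
  simp [chainMap]

theorem bdry_basis (r : V → ℕ) (K : Finset V → Prop) (c : ℕ) (σ : Finset V)
    (h : K σ ∧ σ.card = c + 1) :
    bdry R r K c (basisOrZero R K (c + 1) σ)
      = ∑ v ∈ σ, ((-1 : ℤ) ^ ((σ.filter fun u => r u < r v).card) •
        basisOrZero R K c (σ.erase v)) := by
  rw [basisOrZero_pos R K _ σ h]
  simp [bdry]

theorem chain_ext {M : Type*} [AddCommGroup M] [Module R M] (K : Finset V → Prop) (c : ℕ)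
    (F G : SChain R K c →ₗ[R] M)
    (h : ∀ σ, K σ → σ.card = c → F (basisOrZero R K c σ) = G (basisOrZero R K c σ)) : F = G := by
  refine Finsupp.lhom_ext' fun σ => LinearMap.ext_ring ?_
  have := h σ.1 σ.2.1 σ.2.2
  rw [basisOrZero_pos R K c σ.1 σ.2] at this
  exact this

theorem not_injOn_card (f : V → W) (σ : Finset V) (c : ℕ) (hc : σ.card = c)
    (h : ¬ Set.InjOn f (σ : Set V)) : (σ.image f).card ≠ c := by
  intro e
  exact h (Finset.card_image_iff.1 (e.trans hc.symm))

theorem chainMap_comp (r : V → ℕ) (r' : W → ℕ) (r'' : X → ℕ)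
    (hr : Function.Injective r) (hr' : Function.Injective r') (hr'' : Function.Injective r'')
    (f : V → W) (f' : W → X) (K : Finset V → Prop) (K' : Finset W → Prop) (K'' : Finset X → Prop)
    (hK : ∀ σ, K σ → Set.InjOn f (σ : Set V) → K' (σ.image f)) (c : ℕ) :
    chainMap R r' r'' f' K' K'' c ∘ₗ chainMap R r r' f K K' c
      = chainMap R r r'' (f' ∘ f) K K'' c := by
  refine chain_ext R K c _ _ fun σ hσ hc => ?_
  rw [LinearMap.comp_apply, chainMap_basis R _ _ _ _ _ _ _ ⟨hσ, hc⟩,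
    chainMap_basis R _ _ _ _ _ _ _ ⟨hσ, hc⟩, map_zsmul]
  by_cases hi : Set.InjOn f (σ : Set V)
  · have hc' : (σ.image f).card = c := by rw [Finset.card_image_of_injOn hi, hc]
    rw [chainMap_basis R _ _ _ _ _ _ _ ⟨hK σ hσ hi, hc'⟩, Finset.image_image]
    by_cases hi2 : Set.InjOn (f' ∘ f) (σ : Set V)
    · rw [mapSign_comp r r' r'' hr hr' hr'' f f' σ hi2, mul_smul]
    · rw [basisOrZero_neg R K'' c _ (fun e => not_injOn_card _ _ _ hc hi2 e.2)]
      simp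
  · have hi2 : ¬ Set.InjOn (f' ∘ f) (σ : Set V) := fun h => hi fun x hx y hy e =>
      h hx hy (by simp [e])
    rw [basisOrZero_neg R K'' c _ (fun e => not_injOn_card _ _ _ hc hi2 e.2),
      basisOrZero_neg R K' c _ (fun e => not_injOn_card _ _ _ hc hi e.2)]
    simp

theorem sign_bdry (r : V → ℕ) (r' : W → ℕ) (hr : Function.Injective r)
    (hr' : Function.Injective r') (f : V → W) (σ : Finset V) (hi : Set.InjOn f (σ : Set V))
    (v : V) (hv : v ∈ σ) :
    mapSign r r' f σ * (-1 : ℤ) ^ (((σ.image f).filter fun u => r' u < r' (f v)).card)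
      = (-1 : ℤ) ^ ((σ.filter fun u => r u < r v).card) * mapSign r r' f (σ.erase v) := by
  have e1 : mapSign r r' f σ = mapSign r r' f (σ.erase v) * ∏ u ∈ σ.erase v, inv2 r r' f v u := by
    conv_lhs => rw [← Finset.insert_erase hv]
    exact mapSign_insert _ _ _ _ _ (by simp)
  have e2 : ∀ (s : V → ℕ), (-1 : ℤ) ^ ((σ.filter fun u => s u < s v).card)
      = ∏ u ∈ σ.erase v, (if s u < s v then (-1 : ℤ) else 1) := by
    intro s
    rw [Finset.prod_erase σ (f := fun u => if s u < s v then (-1 : ℤ) else 1) (a := v) (by simp)]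
    rw [Finset.prod_ite]
    simp
  have e3 : (((σ.image f).filter fun u => r' u < r' (f v)).card)
      = ((σ.filter fun u => (r' ∘ f) u < (r' ∘ f) v).card) := by
    rw [Finset.filter_image, Finset.card_image_of_injOn]
    · rfl
    · exact hi.mono (by intro x hx; simp at hx; exact hx.1)
  rw [e3, e2, e2, e1, mul_comm (∏ u ∈ _, _) (mapSign _ _ _ _), mul_assoc,
    ← Finset.prod_mul_distrib]
  congr 1
  refine Finset.prod_congr rfl fun u hu => ?_
  simp only [Finset.mem_erase] at hu
  have h1 := hr.ne hu.1
  have h2 : r' (f u) ≠ r' (f v) := fun e => hu.1 (hi hu.2 hv (hr' e))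
  simp only [inv2, inv1, Function.comp]
  split_ifs <;> first | omega | norm_num

theorem chainMap_bdry_basis (r : V → ℕ) (r' : W → ℕ) (hr : Function.Injective r)
    (hr' : Function.Injective r') (f : V → W) (K : Finset V → Prop) (K' : Finset W → Prop)
    (hsub : ∀ σ τ, K σ → τ ⊆ σ → K τ)
    (hK : ∀ σ, K σ → Set.InjOn f (σ : Set V) → K' (σ.image f)) (c : ℕ) (σ : Finset V)
    (hσ : K σ) (hc : σ.card = c + 1) (hi : Set.InjOn f (σ : Set V)) :
    bdry R r' K' c (chainMap R r r' f K K' (c + 1) (basisOrZero R K (c + 1) σ))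
      = chainMap R r r' f K K' c (bdry R r K c (basisOrZero R K (c + 1) σ)) := by
  rw [chainMap_basis R _ _ _ _ _ _ _ ⟨hσ, hc⟩, bdry_basis R _ _ _ _ ⟨hσ, hc⟩, map_zsmul,
    bdry_basis R _ _ _ _ ⟨hK σ hσ hi, by rw [Finset.card_image_of_injOn hi, hc]⟩,
    Finset.sum_image hi, Finset.smul_sum, map_sum]
  refine Finset.sum_congr rfl fun v hv => ?_
  rw [map_zsmul, chainMap_basis R _ _ _ _ _ _ _
    ⟨hsub _ _ hσ (Finset.erase_subset _ _), by rw [Finset.card_erase_of_mem hv, hc]; rfl⟩,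
    smul_smul, smul_smul, sign_bdry r r' hr hr' f σ hi v hv]
  congr 2
  ext x
  simp only [Finset.mem_erase, Finset.mem_image]
  constructor
  · rintro ⟨h, y, hy, rfl⟩
    exact ⟨y, ⟨fun e => h (by rw [e]), hy⟩, rfl⟩
  · rintro ⟨y, ⟨h, hy⟩, rfl⟩
    exact ⟨fun e => h (hi hy hv e), y, hy, rfl⟩

end Chain

section LinAlg

variable {R : Type*} [CommRing R] {C2 C1 C0 D2 D1 D0 : Type*}
  [AddCommGroup C2] [Module R C2] [AddCommGroup C1] [Module R C1] [AddCommGroup C0] [Module R C0]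
  [AddCommGroup D2] [Module R D2] [AddCommGroup D1] [Module R D1] [AddCommGroup D0] [Module R D0]

theorem split_homology (b1 : C2 →ₗ[R] C1) (b0 : C1 →ₗ[R] C0) (a1 : D2 →ₗ[R] D1)
    (a0 : D1 →ₗ[R] D0) (k2 : C2 →ₗ[R] D2) (k1 : C1 →ₗ[R] D1) (k0 : C0 →ₗ[R] D0)
    (s2 : D2 →ₗ[R] C2) (s1 : D1 →ₗ[R] C1) (s0 : D0 →ₗ[R] C0)
    (hk1 : ∀ x, k1 (b1 x) = a1 (k2 x)) (hk0 : ∀ x, k0 (b0 x) = a0 (k1 x))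
    (hs1 : ∀ x, s1 (a1 x) = b1 (s2 x)) (hs0 : ∀ x, s0 (a0 x) = b0 (s1 x))
    (hks2 : ∀ x, k2 (s2 x) = x) (hks1 : ∀ x, k1 (s1 x) = x)
    (S2 : Submodule R C2) (S1 : Submodule R C1)
    (hS2 : S2 = LinearMap.ker k2) (hS1 : S1 = LinearMap.ker k1) :
    Nonempty (subQuotL R (LinearMap.ker b0) (LinearMap.range b1) ≃ₗ[R]
      subQuotL R (LinearMap.ker a0) (LinearMap.range a1) ×
      subQuotL R (S1 ⊓ LinearMap.ker b0) (S2.map b1)) := by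
  subst hS2 hS1
  let P1 : LinearMap.ker b0 →ₗ[R] LinearMap.ker a0 :=
    k1.restrict (fun x hx => by
      rw [LinearMap.mem_ker] at hx ⊢
      rw [← hk0, hx, map_zero])
  let P2 : LinearMap.ker b0 →ₗ[R] (LinearMap.ker k1 ⊓ LinearMap.ker b0 : Submodule R C1) :=
    (LinearMap.id - s1 ∘ₗ k1).restrict (fun x hx => by
      rw [LinearMap.mem_ker] at hx
      refine ⟨?_, ?_⟩
      · simp [hks1]
      · simp [← hs0, ← hk0, hx])
  let F := ((Submodule.mkQ ((LinearMap.range a1).comap (LinearMap.ker a0).subtype)) ∘ₗ P1).prod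
    ((Submodule.mkQ (((LinearMap.ker k2).map b1).comap
      (LinearMap.ker k1 ⊓ LinearMap.ker b0 : Submodule R C1).subtype)) ∘ₗ P2)
  have hsurj : Function.Surjective F := by
    rintro ⟨y, w⟩
    obtain ⟨⟨y, hy⟩, rfl⟩ := Submodule.mkQ_surjective _ y
    obtain ⟨⟨w, hw1, hw2⟩, rfl⟩ := Submodule.mkQ_surjective _ w
    have hw1' : k1 w = 0 := hw1
    have hw2' : b0 w = 0 := hw2
    have hy' : a0 y = 0 := hy
    refine ⟨⟨s1 y + w, ?_⟩, ?_⟩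
    · rw [LinearMap.mem_ker, map_add, ← hs0, hy', hw2', map_zero, add_zero]
    · refine Prod.ext ?_ ?_
      · refine congrArg (Submodule.mkQ _) (Subtype.ext ?_)
        show k1 (s1 y + w) = y
        rw [map_add, hks1, hw1', add_zero]
      · refine congrArg (Submodule.mkQ _) (Subtype.ext ?_)
        show (s1 y + w) - s1 (k1 (s1 y + w)) = w
        rw [map_add, hks1, hw1', add_zero, add_sub_cancel_left]
  have hker : (LinearMap.range b1).comap (LinearMap.ker b0).subtype = LinearMap.ker F := by
    ext ⟨z, hz⟩
    rw [LinearMap.mem_ker]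
    show z ∈ LinearMap.range b1 ↔ _
    have : F ⟨z, hz⟩ = 0 ↔ (k1 z ∈ LinearMap.range a1) ∧ (z - s1 (k1 z)) ∈
        (LinearMap.ker k2).map b1 := by
      rw [Prod.ext_iff]
      refine and_congr ?_ ?_
      · exact Submodule.Quotient.mk_eq_zero _
      · exact Submodule.Quotient.mk_eq_zero _
    rw [this]
    constructor
    · rintro ⟨x, rfl⟩
      refine ⟨⟨k2 x, (hk1 x).symm⟩, x - s2 (k2 x), ?_, ?_⟩
      · simp [hks2]
      · rw [map_sub, ← hs1, hk1]
    · rintro ⟨⟨y, hy⟩, ⟨w, _, hw⟩⟩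
      refine ⟨s2 y + w, ?_⟩
      rw [map_add, ← hs1, hy, hw]
      abel
  exact ⟨(Submodule.quotEquivOfEq _ _ hker).trans (F.quotKerEquivOfSurjective hsurj)⟩

end LinAlg

end MatchPaper

namespace MatchPaper

section Comb

variable {N n : ℕ}

theorem rankP_inj (m : ℕ) : Function.Injective (rankP m) := by
  rintro ⟨a, b⟩ ⟨c, d⟩ h
  simp only [rankP] at h
  have hm : 0 < m := lt_of_le_of_lt (Nat.zero_le _) b.2
  have h1 : (a.val * m + b.val) / m = a.val := by
    rw [add_comm, Nat.add_mul_div_right _ _ hm, Nat.div_eq_of_lt b.2, zero_add]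
  have h2 : (c.val * m + d.val) / m = c.val := by
    rw [add_comm, Nat.add_mul_div_right _ _ hm, Nat.div_eq_of_lt d.2, zero_add]
  have h3 : a.val = c.val := by rw [← h1, ← h2, h]
  have h4 : b.val = d.val := by rw [h3] at h; omega
  exact Prod.ext (Fin.ext h3) (Fin.ext h4)

theorem isMatching_sub (σ τ : Finset (Fin N × Fin N)) (h : IsMatching N σ) (hs : τ ⊆ σ) :
    IsMatching N τ :=
  ⟨fun p hp => h.1 p (hs hp), fun p hp q hq => h.2 p (hs hp) q (hs hq)⟩

theorem emap_comp (g h : Equiv.Perm (Fin N)) : emap g ∘ emap h = emap (g * h) := by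
  funext p
  simp only [emap, Function.comp, Equiv.Perm.mul_apply]
  rcases le_total (h p.1) (h p.2) with e | e
  · rw [min_eq_left e, max_eq_right e]
  · rw [min_eq_right e, max_eq_left e, min_comm, max_comm]

theorem kmap_emap (kap : Fin N → Fin n) (g : Equiv.Perm (Fin N)) (hg : KeepsBlocks kap g) :
    kmap kap ∘ emap g = kmap kap := by
  funext p
  simp only [emap, kmap, Function.comp]
  rcases le_total (g p.1) (g p.2) with e | e
  · rw [min_eq_left e, max_eq_right e, hg, hg]
  · rw [min_eq_right e, max_eq_left e, hg, hg, min_comm, max_comm]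

theorem emap_one (p : Fin N × Fin N) (hp : p.1 < p.2) : emap 1 p = p := by
  simp [emap, min_eq_left hp.le, max_eq_right hp.le]

theorem emap_injOn (σ : Finset (Fin N × Fin N)) (h : IsMatching N σ) (g : Equiv.Perm (Fin N)) :
    Set.InjOn (emap g) (σ : Set (Fin N × Fin N)) := by
  intro p hp q hq e
  have e2 := congrArg (emap g⁻¹) e
  have hc := emap_comp g⁻¹ g
  rw [inv_mul_cancel] at hc
  have e3 : emap 1 p = emap 1 q := by rw [← hc]; exact e2
  rwa [emap_one p (h.1 p hp), emap_one q (h.1 q hq)] at e3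

theorem emap_matching (σ : Finset (Fin N × Fin N)) (h : IsMatching N σ)
    (g : Equiv.Perm (Fin N)) : IsMatching N (σ.image (emap g)) := by
  constructor
  · intro p hp
    obtain ⟨q, hq, rfl⟩ := Finset.mem_image.1 hp
    exact min_lt_max.2 (g.injective.ne (h.1 q hq).ne)
  · intro p hp q hq hne
    obtain ⟨a, ha, rfl⟩ := Finset.mem_image.1 hp
    obtain ⟨b, hb, rfl⟩ := Finset.mem_image.1 hq
    have hab : a ≠ b := fun e => hne (by rw [e])
    obtain ⟨h1, h2, h3, h4⟩ := h.2 a ha b hb hab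
    have h1 := g.injective.ne h1
    have h2 := g.injective.ne h2
    have h3 := g.injective.ne h3
    have h4 := g.injective.ne h4
    simp only [emap]
    rcases le_total (g a.1) (g a.2) with e | e <;> rcases le_total (g b.1) (g b.2) with e' | e' <;>
      simp only [min_eq_left, min_eq_right, max_eq_left, max_eq_right, e, e'] <;>
      exact ⟨by assumption, by assumption, by assumption, by assumption⟩

/-- The endpoint function on half-edges. -/
def hend (τ : Finset (Fin n × Fin n)) (h : {p // p ∈ τ} × Bool) : Fin n :=
  if h.2 then h.1.1.2 else h.1.1.1

/-- The ordered edge with the two given ends. -/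
def sortp (a b : Fin N) : Fin N × Fin N := (min a b, max a b)

theorem degB_eq (τ : Finset (Fin n × Fin n)) (i : Fin n) :
    degB τ i = (Finset.univ.filter fun h => hend τ h = i).card := by
  rw [Finset.card_filter, Fintype.sum_prod_type, degB, ← Finset.sum_coe_sort]
  refine Finset.sum_congr rfl fun p _ => ?_
  rw [Fintype.sum_bool]
  simp [hend, add_comm]

theorem exists_rep (kap : Fin N → Fin n) (σ : Finset (Fin N × Fin N)) (h : IsMatching N σ)
    (τ : Finset (Fin n × Fin n)) (hτ : σ.image (kmap kap) = τ)
    (hi : Set.InjOn (kmap kap) (σ : Set (Fin N × Fin N))) :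
    ∃ j : {p // p ∈ τ} × Bool → Fin N, Function.Injective j ∧
      (∀ x, kap (j x) = hend τ x) ∧
      σ = Finset.univ.image (fun p => sortp (j (p, false)) (j (p, true))) := by
  have hex : ∀ p : {p // p ∈ τ}, ∃ e, e ∈ σ ∧ kmap kap e = p.1 := by
    intro p
    have := (Finset.ext_iff.1 hτ p.1).2 p.2
    obtain ⟨e, he, h2⟩ := Finset.mem_image.1 this
    exact ⟨e, he, h2⟩
  choose e he hk using hex
  have hlt : ∀ p, (e p).1 < (e p).2 := fun p => h.1 _ (he p)
  let j : {p // p ∈ τ} × Bool → Fin N := fun x =>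
    if kap (e x.1).1 ≤ kap (e x.1).2 then (if x.2 then (e x.1).2 else (e x.1).1)
    else (if x.2 then (e x.1).1 else (e x.1).2)
  have hj : ∀ x, j x = (e x.1).1 ∨ j x = (e x.1).2 := by
    intro x
    simp only [j]
    split_ifs <;> simp
  have hs : ∀ p, sortp (j (p, false)) (j (p, true)) = e p := by
    intro p
    have := (hlt p).le
    simp only [j, sortp]
    split_ifs <;> simp_all
  refine ⟨j, ?_, ?_, ?_⟩
  · rintro ⟨p, b⟩ ⟨q, b'⟩ hpq
    by_cases hne : p = q
    · subst hne
      have := (hlt p).ne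
      have h2 := this.symm
      simp only [j] at hpq
      cases b <;> cases b' <;> first | rfl | (exfalso; split_ifs at hpq <;> simp_all)
    · exfalso
      have hee : e p ≠ e q := fun hh => hne (Subtype.ext (by rw [← hk, ← hk, hh]))
      obtain ⟨h1, h2, h3, h4⟩ := h.2 _ (he p) _ (he q) hee
      rcases hj (p, b) with a | a <;> rcases hj (q, b') with a' | a' <;>
        rw [a, a'] at hpq <;> simp_all
  · rintro ⟨p, b⟩
    have := hk p
    have h1 : p.1.1 = min (kap (e p).1) (kap (e p).2) := by rw [← this]; rfl
    have h2 : p.1.2 = max (kap (e p).1) (kap (e p).2) := by rw [← this]; rfl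
    simp only [hend, j, h1, h2]
    by_cases hle : kap (e p).1 ≤ kap (e p).2
    · cases b <;> simp [hle]
    · have hle' := (not_le.1 hle).le
      cases b <;> simp [hle, hle']
  · ext q
    simp only [hs, Finset.mem_image, Finset.mem_univ, true_and]
    constructor
    · intro hq
      refine ⟨⟨kmap kap q, hτ ▸ Finset.mem_image_of_mem _ hq⟩, ?_⟩
      exact hi (he _) hq (hk _)
    · rintro ⟨p, rfl⟩
      exact he p

theorem image_BD (lam : Fin n → ℕ) (kap : Fin N → Fin n)
    (hcard : ∀ i : Fin n, (Finset.univ.filter fun x => kap x = i).card = lam i)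
    (σ : Finset (Fin N × Fin N)) (h : IsMatching N σ)
    (hi : Set.InjOn (kmap kap) (σ : Set (Fin N × Fin N))) :
    IsBDGraph lam (σ.image (kmap kap)) := by
  constructor
  · intro p hp
    obtain ⟨q, _, rfl⟩ := Finset.mem_image.1 hp
    exact min_le_max
  · intro i
    obtain ⟨j, hj, hk, _⟩ := exists_rep kap σ h _ rfl hi
    rw [degB_eq, ← hcard]
    refine Finset.card_le_card_of_injOn j ?_ hj.injOn
    intro x hx
    simp only [Finset.coe_filter, Finset.mem_univ, true_and, Set.mem_ofPred_eq] at hx ⊢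
    rw [hk, hx]

theorem exists_lift (lam : Fin n → ℕ) (kap : Fin N → Fin n)
    (hcard : ∀ i : Fin n, (Finset.univ.filter fun x => kap x = i).card = lam i)
    (τ : Finset (Fin n × Fin n)) (h : IsBDGraph lam τ) :
    ∃ σ, IsMatching N σ ∧ Set.InjOn (kmap kap) (σ : Set (Fin N × Fin N)) ∧
      σ.image (kmap kap) = τ := by
  have hemb : ∀ i, Nonempty ({x // hend τ x = i} ↪ {x // kap x = i}) := by
    intro i
    refine Function.Embedding.nonempty_of_card_le ?_
    rw [Fintype.card_subtype, Fintype.card_subtype, hcard, ← degB_eq]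
    exact h.2 i
  let E := fun i => (hemb i).some
  let j : {p // p ∈ τ} × Bool → Fin N := fun x => (E (hend τ x) ⟨x, rfl⟩).1
  have hk : ∀ x, kap (j x) = hend τ x := fun x => (E (hend τ x) ⟨x, rfl⟩).2
  have hj : Function.Injective j := by
    intro x y hxy
    have he : hend τ x = hend τ y := by rw [← hk, ← hk, hxy]
    have gen : ∀ i (hx : hend τ x = i), j x = (E i ⟨x, hx⟩).1 := by
      rintro i rfl; rfl
    rw [gen _ he] at hxy
    have := (E (hend τ y)).injective (Subtype.ext hxy)
    exact congrArg Subtype.val this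
  have hkm : ∀ p : {p // p ∈ τ}, kmap kap (sortp (j (p, false)) (j (p, true))) = p.1 := by
    intro p
    have h1 : kap (j (p, false)) = p.1.1 := by rw [hk]; simp [hend]
    have h2 : kap (j (p, true)) = p.1.2 := by rw [hk]; simp [hend]
    have h3 := h.1 p.1 p.2
    simp only [kmap, sortp]
    rcases le_total (j (p, false)) (j (p, true)) with e | e
    · rw [min_eq_left e, max_eq_right e, h1, h2, min_eq_left h3, max_eq_right h3]
    · rw [min_eq_right e, max_eq_left e, h1, h2, min_eq_right h3, max_eq_left h3]
  refine ⟨Finset.univ.image (fun p => sortp (j (p, false)) (j (p, true))), ⟨?_, ?_⟩, ?_, ?_⟩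
  · intro q hq
    obtain ⟨p, _, rfl⟩ := Finset.mem_image.1 hq
    exact min_lt_max.2 (hj.ne (by simp))
  · intro q hq q' hq' hne
    obtain ⟨p, _, rfl⟩ := Finset.mem_image.1 hq
    obtain ⟨p', _, rfl⟩ := Finset.mem_image.1 hq'
    have hp : p ≠ p' := fun e => hne (by rw [e])
    have hd : ∀ b b', j (p, b) ≠ j (p', b') := fun b b' => hj.ne (by simp [hp])
    simp only [sortp]
    rcases le_total (j (p, false)) (j (p, true)) with e | e <;>
      rcases le_total (j (p', false)) (j (p', true)) with e' | e' <;>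
      simp only [min_eq_left, min_eq_right, max_eq_left, max_eq_right, e, e'] <;>
      exact ⟨hd _ _, hd _ _, hd _ _, hd _ _⟩
  · intro q hq q' hq' hqq
    simp only [Finset.coe_image, Finset.coe_univ, Set.image_univ, Set.mem_range] at hq hq'
    obtain ⟨p, rfl⟩ := hq
    obtain ⟨p', rfl⟩ := hq'
    rw [hkm, hkm] at hqq
    rw [Subtype.ext hqq]
  · ext q
    simp only [Finset.mem_image, Finset.mem_univ, true_and]
    constructor
    · rintro ⟨_, ⟨p, rfl⟩, rfl⟩
      rw [hkm]
      exact p.2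
    · intro hq
      exact ⟨_, ⟨⟨q, hq⟩, rfl⟩, hkm _⟩

theorem exists_perm {H : Type*} [Fintype H] (kap : Fin N → Fin n) (j j' : H → Fin N)
    (hj : Function.Injective j) (hj' : Function.Injective j') (hk : ∀ x, kap (j x) = kap (j' x)) :
    ∃ g : Equiv.Perm (Fin N), KeepsBlocks kap g ∧ ∀ x, g (j x) = j' x := by
  classical
  suffices ∀ s : Finset H, ∃ g : Equiv.Perm (Fin N), KeepsBlocks kap g ∧ ∀ x ∈ s, g (j x) = j' x by
    obtain ⟨g, h1, h2⟩ := this Finset.univ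
    exact ⟨g, h1, fun x => h2 x (Finset.mem_univ _)⟩
  intro s
  induction s using Finset.induction_on with
  | empty => exact ⟨1, fun x => rfl, by simp⟩
  | insert a s ha ih =>
    obtain ⟨g, h1, h2⟩ := ih
    refine ⟨Equiv.swap (g (j a)) (j' a) * g, ?_, ?_⟩
    · intro x
      rw [Equiv.Perm.mul_apply]
      have hka : kap (g (j a)) = kap (j' a) := by rw [h1, hk]
      rw [← h1 x, Equiv.swap_apply_def]
      split_ifs with e1 e2
      · rw [e1, hka]
      · rw [e2, hka]
      · rfl
    · intro x hx
      rw [Equiv.Perm.mul_apply]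
      rcases Finset.mem_insert.1 hx with rfl | hx
      · exact Equiv.swap_apply_left _ _
      · have hxa : x ≠ a := fun e => ha (e ▸ hx)
        rw [Equiv.swap_apply_of_ne_of_ne, h2 x hx]
        · exact g.injective.ne (hj.ne hxa)
        · rw [h2 x hx]
          exact hj'.ne hxa

theorem exists_orbit (kap : Fin N → Fin n) (σ σ' : Finset (Fin N × Fin N))
    (h : IsMatching N σ) (h' : IsMatching N σ')
    (hi : Set.InjOn (kmap kap) (σ : Set (Fin N × Fin N)))
    (hi' : Set.InjOn (kmap kap) (σ' : Set (Fin N × Fin N)))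
    (he : σ.image (kmap kap) = σ'.image (kmap kap)) :
    ∃ g : Equiv.Perm (Fin N), KeepsBlocks kap g ∧ σ.image (emap g) = σ' := by
  obtain ⟨j, hj, hk, hs⟩ := exists_rep kap σ h _ he hi
  obtain ⟨j', hj', hk', hs'⟩ := exists_rep kap σ' h' _ rfl hi'
  obtain ⟨g, hg, hgj⟩ := exists_perm kap j j' hj hj' (fun x => by rw [hk, hk'])
  refine ⟨g, hg, ?_⟩
  conv_rhs => rw [hs']
  rw [hs, Finset.image_image]
  refine Finset.image_congr fun p _ => ?_
  simp only [Function.comp, emap, sortp]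
  rcases le_total (j (p, false)) (j (p, true)) with e | e
  · rw [min_eq_left e, max_eq_right e, hgj, hgj]
  · rw [min_eq_right e, max_eq_left e, hgj, hgj, min_comm, max_comm]

theorem exists_swap (kap : Fin N → Fin n) (σ : Finset (Fin N × Fin N))
    (h : IsMatching N σ) (hi : ¬ Set.InjOn (kmap kap) (σ : Set (Fin N × Fin N))) :
    ∃ g : Equiv.Perm (Fin N), KeepsBlocks kap g ∧ ∃ p ∈ σ, ∃ q ∈ σ, p ≠ q ∧ emap g p = q ∧
      emap g q = p ∧ (∀ u ∈ σ, u ≠ p → u ≠ q → emap g u = u) ∧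
      ∃ a b : Fin N, a ≠ b ∧ kap a = kap b := by
  simp only [Set.InjOn, not_forall] at hi
  obtain ⟨p, hp, q, hq, hk, hpq⟩ := hi
  have main : ∀ a b : Fin N, sortp a b = q → kap p.1 = kap a → kap p.2 = kap b →
      (∀ u ∈ σ, u ≠ q → u.1 ≠ a ∧ u.1 ≠ b ∧ u.2 ≠ a ∧ u.2 ≠ b) → a ≠ b →
      ∃ g : Equiv.Perm (Fin N), KeepsBlocks kap g ∧ ∃ p ∈ σ, ∃ q ∈ σ, p ≠ q ∧ emap g p = q ∧
      emap g q = p ∧ (∀ u ∈ σ, u ≠ p → u ≠ q → emap g u = u) ∧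
      ∃ a b : Fin N, a ≠ b ∧ kap a = kap b := by
    intro a b hs h1 h2 hu hab
    have hlt := h.1 p hp
    obtain ⟨n1, n2, n3, n4⟩ := hu p hp hpq
    have n5 := hlt.ne
    have ga : (Equiv.swap p.1 a * Equiv.swap p.2 b) a = p.1 := by
      rw [Equiv.Perm.mul_apply, Equiv.swap_apply_of_ne_of_ne n3.symm hab, Equiv.swap_apply_right]
    have gb : (Equiv.swap p.1 a * Equiv.swap p.2 b) b = p.2 := by
      rw [Equiv.Perm.mul_apply, Equiv.swap_apply_right, Equiv.swap_apply_of_ne_of_ne n5.symm n3]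
    have gp1 : (Equiv.swap p.1 a * Equiv.swap p.2 b) p.1 = a := by
      rw [Equiv.Perm.mul_apply, Equiv.swap_apply_of_ne_of_ne n5 n2, Equiv.swap_apply_left]
    have gp2 : (Equiv.swap p.1 a * Equiv.swap p.2 b) p.2 = b := by
      rw [Equiv.Perm.mul_apply, Equiv.swap_apply_left,
        Equiv.swap_apply_of_ne_of_ne n2.symm hab.symm]
    have gf : ∀ x, x ≠ p.1 → x ≠ p.2 → x ≠ a → x ≠ b →
        (Equiv.swap p.1 a * Equiv.swap p.2 b) x = x := by
      intro x y1 y2 y3 y4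
      rw [Equiv.Perm.mul_apply, Equiv.swap_apply_of_ne_of_ne y2 y4,
        Equiv.swap_apply_of_ne_of_ne y1 y3]
    refine ⟨Equiv.swap p.1 a * Equiv.swap p.2 b, ?_, p, hp, q, hq, hpq, ?_, ?_, ?_,
      p.1, a, n1, h1⟩
    · intro x
      by_cases y1 : x = p.1
      · rw [y1, gp1, h1]
      by_cases y2 : x = p.2
      · rw [y2, gp2, h2]
      by_cases y3 : x = a
      · rw [y3, ga, h1]
      by_cases y4 : x = b
      · rw [y4, gb, h2]
      rw [gf x y1 y2 y3 y4]
    · simp only [emap]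
      rw [gp1, gp2]
      exact hs
    · have : emap (Equiv.swap p.1 a * Equiv.swap p.2 b) q = sortp p.1 p.2 := by
        rw [← hs]
        simp only [emap, sortp]
        rcases le_total a b with e | e
        · rw [min_eq_left e, max_eq_right e, ga, gb]
        · rw [min_eq_right e, max_eq_left e, ga, gb, min_comm, max_comm]
      rw [this, sortp, min_eq_left hlt.le, max_eq_right hlt.le]
    · intro u hm up uq
      obtain ⟨m1, m2, m3, m4⟩ := hu u hm uq
      obtain ⟨l1, l2, l3, l4⟩ := h.2 u hm p hp up
      have := (h.1 u hm).le
      simp only [emap]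
      rw [gf _ l1 l2 m1 m2, gf _ l3 l4 m3 m4, min_eq_left this, max_eq_right this]
  have hq12 := h.1 q hq
  have hsp : (kap p.1 = kap q.1 ∧ kap p.2 = kap q.2) ∨ (kap p.1 = kap q.2 ∧ kap p.2 = kap q.1) := by
    simp only [kmap, Prod.mk.injEq] at hk
    rcases le_total (kap p.1) (kap p.2) with e | e <;>
      rcases le_total (kap q.1) (kap q.2) with e' | e' <;>
      simp only [min_eq_left, min_eq_right, max_eq_left, max_eq_right, e, e'] at hk <;> tauto
  rcases hsp with ⟨h1, h2⟩ | ⟨h1, h2⟩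
  · refine main q.1 q.2 ?_ h1 h2 ?_ hq12.ne
    · rw [sortp, min_eq_left hq12.le, max_eq_right hq12.le]
    · intro u hu huq
      exact h.2 u hu q hq huq
  · refine main q.2 q.1 ?_ h1 h2 ?_ hq12.ne'
    · rw [sortp, min_eq_right hq12.le, max_eq_left hq12.le]
    · intro u hu huq
      obtain ⟨l1, l2, l3, l4⟩ := h.2 u hu q hq huq
      exact ⟨l2, l1, l4, l3⟩

theorem card_young (lam : Fin n → ℕ) (kap : Fin N → Fin n)
    (hcard : ∀ i : Fin n, (Finset.univ.filter fun x => kap x = i).card = lam i) :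
    (Finset.univ.filter fun g : Equiv.Perm (Fin N) => kap ∘ g = kap).card
      = ∏ i, Nat.factorial (lam i) := by
  rw [← Fintype.card_subtype, DomMulAct.stabilizer_card]
  refine Finset.prod_congr rfl fun i _ => ?_
  rw [Fintype.card_subtype, hcard]

theorem two_unit (R : Type*) [CommRing R] (lam : Fin n → ℕ) (kap : Fin N → Fin n)
    (hcard : ∀ i : Fin n, (Finset.univ.filter fun x => kap x = i).card = lam i)
    (hunit : IsUnit ((∏ i, Nat.factorial (lam i) : ℕ) : R)) (a b : Fin N) (hab : a ≠ b)
    (hk : kap a = kap b) : IsUnit (2 : R) := by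
  have h2 : 2 ≤ lam (kap a) := by
    rw [← hcard]
    exact Finset.one_lt_card.2 ⟨a, by simp, b, by simp [hk], hab⟩
  have hd : 2 ∣ ∏ i, Nat.factorial (lam i) :=
    (Nat.dvd_factorial (by norm_num) h2).trans
      (Finset.dvd_prod_of_mem (fun i => Nat.factorial (lam i)) (Finset.mem_univ (kap a)))
  have hd2 : ((2 : ℕ) : R) ∣ ((∏ i, Nat.factorial (lam i) : ℕ) : R) := Nat.cast_dvd_cast hd
  have := isUnit_of_dvd_unit hd2 hunit
  exact_mod_cast this

end Comb

end MatchPaper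

namespace MatchPaper

section Final

variable (R : Type*) [CommRing R] (N n : ℕ) (lam : Fin n → ℕ) (kap : Fin N → Fin n)

theorem actC_mul (g h : Equiv.Perm (Fin N)) (c : ℕ) (x : SChain R (IsMatching N) c) :
    actC R N (IsMatching N) g c (actC R N (IsMatching N) h c x)
      = actC R N (IsMatching N) (g * h) c x := by
  have := chainMap_comp R (rankP N) (rankP N) (rankP N) (rankP_inj N) (rankP_inj N) (rankP_inj N)
    (emap h) (emap g) (IsMatching N) (IsMatching N) (IsMatching N)
    (fun σ hσ _ => emap_matching σ hσ h) c
  rw [emap_comp] at this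
  exact LinearMap.congr_fun this x

theorem actC_bdry (g : Equiv.Perm (Fin N)) (c : ℕ) (x : SChain R (IsMatching N) (c + 1)) :
    bdry R (rankP N) (IsMatching N) c (actC R N (IsMatching N) g (c + 1) x)
      = actC R N (IsMatching N) g c (bdry R (rankP N) (IsMatching N) c x) := by
  have : bdry R (rankP N) (IsMatching N) c ∘ₗ actC R N (IsMatching N) g (c + 1)
      = actC R N (IsMatching N) g c ∘ₗ bdry R (rankP N) (IsMatching N) c := by
    refine chain_ext R _ _ _ _ fun σ hσ hc => ?_
    exact chainMap_bdry_basis R _ _ (rankP_inj N) (rankP_inj N) (emap g) _ _ isMatching_sub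
      (fun σ hσ _ => emap_matching σ hσ g) c σ hσ hc (emap_injOn σ hσ g)
  exact LinearMap.congr_fun this x

/-- The chain map `κ` on all of the matching complex. -/
noncomputable def kapC (c : ℕ) : SChain R (IsMatching N) c →ₗ[R] SChain R (IsBDGraph lam) c :=
  chainMap R (rankP N) (rankP n) (kmap kap) (IsMatching N) (IsBDGraph lam) c

theorem kapC_act (g : Equiv.Perm (Fin N)) (hg : KeepsBlocks kap g) (c : ℕ)
    (x : SChain R (IsMatching N) c) :
    kapC R N n lam kap c (actC R N (IsMatching N) g c x) = kapC R N n lam kap c x := by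
  have := chainMap_comp R (rankP N) (rankP N) (rankP n) (rankP_inj N) (rankP_inj N) (rankP_inj n)
    (emap g) (kmap kap) (IsMatching N) (IsMatching N) (IsBDGraph lam)
    (fun σ hσ _ => emap_matching σ hσ g) c
  rw [kmap_emap kap g hg] at this
  exact LinearMap.congr_fun this x

theorem act_swap_basis (σ : Finset (Fin N × Fin N)) (c : ℕ) (hσ : IsMatching N σ)
    (hc : σ.card = c) (g : Equiv.Perm (Fin N)) (p q : Fin N × Fin N) (hp : p ∈ σ) (hq : q ∈ σ)
    (hpq : p ≠ q) (fp : emap g p = q) (fq : emap g q = p)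
    (hf : ∀ u ∈ σ, u ≠ p → u ≠ q → emap g u = u) :
    actC R N (IsMatching N) g c (basisOrZero R (IsMatching N) c σ)
      = - basisOrZero R (IsMatching N) c σ := by
  have him : σ.image (emap g) = σ := by
    refine Finset.eq_of_subset_of_card_le ?_ ?_
    · intro x hx
      obtain ⟨u, hu, rfl⟩ := Finset.mem_image.1 hx
      by_cases h1 : u = p
      · rw [h1, fp]; exact hq
      by_cases h2 : u = q
      · rw [h2, fq]; exact hp
      rw [hf u hu h1 h2]; exact hu
    · rw [Finset.card_image_of_injOn (emap_injOn σ hσ g)]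
  rw [actC, chainMap_basis R _ _ _ _ _ _ _ ⟨hσ, hc⟩, him,
    mapSign_swap _ (rankP_inj N) _ σ p q hp hq hpq fp fq hf, neg_one_smul]

theorem unit_two_zero {M : Type*} [AddCommGroup M] [Module R M] (h : IsUnit (2 : R)) (x : M)
    (hx : x = -x) : x = 0 := by
  have h2 : (2 : R) • x = 0 := by
    rw [two_smul]
    nth_rewrite 1 [hx]
    exact neg_add_cancel x
  exact (h.smul_eq_zero).1 h2

theorem kapC_bdry
    (hcard : ∀ i : Fin n, (Finset.univ.filter fun x => kap x = i).card = lam i)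
    (hunit : IsUnit ((∏ i, Nat.factorial (lam i) : ℕ) : R))
    (c : ℕ) (x : SChain R (IsMatching N) (c + 1)) :
    kapC R N n lam kap c (bdry R (rankP N) (IsMatching N) c x)
      = bdry R (rankP n) (IsBDGraph lam) c (kapC R N n lam kap (c + 1) x) := by
  have : kapC R N n lam kap c ∘ₗ bdry R (rankP N) (IsMatching N) c
      = bdry R (rankP n) (IsBDGraph lam) c ∘ₗ kapC R N n lam kap (c + 1) := by
    refine chain_ext R _ _ _ _ fun σ hσ hc => ?_
    rw [LinearMap.comp_apply, LinearMap.comp_apply]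
    by_cases hi : Set.InjOn (kmap kap) (σ : Set (Fin N × Fin N))
    · exact (chainMap_bdry_basis R _ _ (rankP_inj N) (rankP_inj n) (kmap kap) _ _ isMatching_sub
        (fun σ hσ h => image_BD lam kap hcard σ hσ h) c σ hσ hc hi).symm
    · obtain ⟨g, hg, p, hp, q, hq, hpq, fp, fq, hf, a, b, hab, hk⟩ := exists_swap kap σ hσ hi
      have h2 := two_unit R lam kap hcard hunit a b hab hk
      have hs := act_swap_basis R N σ (c + 1) hσ hc g p q hp hq hpq fp fq hf
      have hz : kapC R N n lam kap (c + 1) (basisOrZero R (IsMatching N) (c + 1) σ) = 0 := by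
        refine unit_two_zero R h2 _ ?_
        rw [← map_neg, ← hs, kapC_act R N n lam kap g hg]
      rw [hz, map_zero]
      refine unit_two_zero R h2 _ ?_
      rw [← map_neg, ← map_neg, ← hs, actC_bdry, kapC_act R N n lam kap g hg]
  exact LinearMap.congr_fun this x

theorem exists_T
    (hcard : ∀ i : Fin n, (Finset.univ.filter fun x => kap x = i).card = lam i)
    (c : ℕ) : ∃ T : SChain R (IsBDGraph lam) c →ₗ[R] SChain R (IsMatching N) c,
    ∀ τ, IsBDGraph lam τ → τ.card = c → ∃ σ, IsMatching N σ ∧ σ.card = c ∧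
      Set.InjOn (kmap kap) (σ : Set (Fin N × Fin N)) ∧ σ.image (kmap kap) = τ ∧
      T (basisOrZero R (IsBDGraph lam) c τ)
        = mapSign (rankP N) (rankP n) (kmap kap) σ • basisOrZero R (IsMatching N) c σ := by
  have hex := fun τ : {τ : Finset (Fin n × Fin n) // IsBDGraph lam τ ∧ τ.card = c} =>
    exists_lift lam kap hcard τ.1 τ.2.1
  choose l h1 h2 h3 using hex
  refine ⟨Finsupp.lsum R fun τ => LinearMap.toSpanSingleton R _
    (mapSign (rankP N) (rankP n) (kmap kap) (l τ) • basisOrZero R (IsMatching N) c (l τ)), ?_⟩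
  intro τ hτ hc
  refine ⟨l ⟨τ, hτ, hc⟩, h1 _, ?_, h2 _, h3 _, ?_⟩
  · rw [← Finset.card_image_of_injOn (h2 _), h3]
    exact hc
  · rw [basisOrZero_pos R _ c τ ⟨hτ, hc⟩]
    simp

theorem T_props
    (hcard : ∀ i : Fin n, (Finset.univ.filter fun x => kap x = i).card = lam i)
    (hunit : IsUnit ((∏ i, Nat.factorial (lam i) : ℕ) : R))
    (c : ℕ) : ∃ T : SChain R (IsBDGraph lam) c →ₗ[R] SChain R (IsMatching N) c,
    (∀ y, kapC R N n lam kap c (T y) = y) ∧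
    ∀ x, x - T (kapC R N n lam kap c x) ∈ ysub R N n kap (IsMatching N) c := by
  obtain ⟨T, hT⟩ := exists_T R N n lam kap hcard c
  refine ⟨T, ?_, ?_⟩
  · have : kapC R N n lam kap c ∘ₗ T = LinearMap.id := by
      refine chain_ext R _ _ _ _ fun τ hτ hc => ?_
      obtain ⟨σ, h1, h2, h3, h4, h5⟩ := hT τ hτ hc
      rw [LinearMap.comp_apply, h5, map_zsmul, kapC, chainMap_basis R _ _ _ _ _ _ _ ⟨h1, h2⟩,
        smul_smul, mapSign_sq, h4, one_smul]
      rfl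
    exact fun y => LinearMap.congr_fun this y
  · have key : (ysub R N n kap (IsMatching N) c).mkQ ∘ₗ
        (LinearMap.id - T ∘ₗ kapC R N n lam kap c) = 0 := by
      refine chain_ext R _ _ _ _ fun σ hσ hc => ?_
      rw [LinearMap.comp_apply, LinearMap.zero_apply, Submodule.mkQ_apply,
        Submodule.Quotient.mk_eq_zero]
      rw [LinearMap.sub_apply, LinearMap.comp_apply, LinearMap.id_apply]
      have hmem : ∀ g, KeepsBlocks kap g → ∀ z : SChain R (IsMatching N) c,
          z - actC R N (IsMatching N) g c z ∈ ysub R N n kap (IsMatching N) c :=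
        fun g hg z => Submodule.subset_span ⟨z, g, hg, rfl⟩
      by_cases hi : Set.InjOn (kmap kap) (σ : Set (Fin N × Fin N))
      · have hBD := image_BD lam kap hcard σ hσ hi
        have hcc : (σ.image (kmap kap)).card = c := by rw [Finset.card_image_of_injOn hi, hc]
        obtain ⟨ρ, h1, h2, h3, h4, h5⟩ := hT _ hBD hcc
        obtain ⟨g, hg, hgi⟩ := exists_orbit kap ρ σ h1 hσ h3 hi h4
        rw [kapC, chainMap_basis R _ _ _ _ _ _ _ ⟨hσ, hc⟩, map_zsmul, h5]
        have hcomp := mapSign_comp (rankP N) (rankP N) (rankP n) (rankP_inj N) (rankP_inj N)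
          (rankP_inj n) (emap g) (kmap kap) ρ (by rw [kmap_emap kap g hg]; exact h3)
        rw [kmap_emap kap g hg, hgi] at hcomp
        have hact : actC R N (IsMatching N) g c (basisOrZero R (IsMatching N) c ρ)
            = mapSign (rankP N) (rankP N) (emap g) ρ • basisOrZero R (IsMatching N) c σ := by
          rw [actC, chainMap_basis R _ _ _ _ _ _ _ ⟨h1, h2⟩, hgi]
        have hs1 := mapSign_sq (rankP N) (rankP n) (kmap kap) σ
        have hs2 := mapSign_sq (rankP N) (rankP N) (emap g) ρ
        have := hmem g hg (mapSign (rankP N) (rankP N) (emap g) ρ •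
          basisOrZero R (IsMatching N) c ρ)
        rw [map_zsmul, hact, smul_smul, hs2, one_smul] at this
        rw [smul_smul, hcomp, mul_left_comm, hs1, mul_one, ← neg_mem_iff, neg_sub]
        exact this
      · obtain ⟨g, hg, p, hp, q, hq, hpq, fp, fq, hf, a, b, hab, hk⟩ := exists_swap kap σ hσ hi
        have h2 := two_unit R lam kap hcard hunit a b hab hk
        have hs := act_swap_basis R N σ c hσ hc g p q hp hq hpq fp fq hf
        have hz : kapC R N n lam kap c (basisOrZero R (IsMatching N) c σ) = 0 := by
          refine unit_two_zero R h2 _ ?_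
          rw [← map_neg, ← hs, kapC_act R N n lam kap g hg]
        rw [hz, map_zero, sub_zero]
        have := hmem g hg (basisOrZero R (IsMatching N) c σ)
        rw [hs, sub_neg_eq_add, ← two_smul R] at this
        exact (Submodule.smul_mem_iff_of_isUnit _ h2).1 this
    intro x
    have := LinearMap.congr_fun key x
    rw [LinearMap.comp_apply, LinearMap.zero_apply, Submodule.mkQ_apply,
        Submodule.Quotient.mk_eq_zero] at this
    exact this

theorem ysub_le_ker (c : ℕ) :
    ysub R N n kap (IsMatching N) c ≤ LinearMap.ker (kapC R N n lam kap c) := by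
  refine Submodule.span_le.2 ?_
  rintro _ ⟨x, g, hg, rfl⟩
  simp only [SetLike.mem_coe, LinearMap.mem_ker, map_sub]
  rw [kapC_act R N n lam kap g hg, sub_self]

theorem ysub_eq_ker
    (hcard : ∀ i : Fin n, (Finset.univ.filter fun x => kap x = i).card = lam i)
    (hunit : IsUnit ((∏ i, Nat.factorial (lam i) : ℕ) : R))
    (c : ℕ) :
    ysub R N n kap (IsMatching N) c = LinearMap.ker (kapC R N n lam kap c) := by
  refine le_antisymm (ysub_le_ker R N n lam kap c) ?_
  intro x hx
  obtain ⟨T, _, h2⟩ := T_props R N n lam kap hcard hunit c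
  have := h2 x
  rw [LinearMap.mem_ker] at hx
  rwa [hx, map_zero, sub_zero] at this

/-- The sum over the Young group. -/
noncomputable def symC (c : ℕ) : SChain R (IsMatching N) c →ₗ[R] SChain R (IsMatching N) c :=
  ∑ g ∈ Finset.univ.filter (fun g : Equiv.Perm (Fin N) => kap ∘ g = kap),
    actC R N (IsMatching N) g c

theorem symC_apply (c : ℕ) (x : SChain R (IsMatching N) c) :
    symC R N n kap c x = ∑ g ∈ Finset.univ.filter (fun g : Equiv.Perm (Fin N) => kap ∘ g = kap),
      actC R N (IsMatching N) g c x := by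
  rw [symC, LinearMap.sum_apply]

theorem symC_bdry (c : ℕ) (x : SChain R (IsMatching N) (c + 1)) :
    symC R N n kap c (bdry R (rankP N) (IsMatching N) c x)
      = bdry R (rankP N) (IsMatching N) c (symC R N n kap (c + 1) x) := by
  rw [symC_apply, symC_apply, map_sum]
  exact Finset.sum_congr rfl fun g _ => (actC_bdry R N g c x).symm

theorem symC_ysub (c : ℕ) (x : SChain R (IsMatching N) c)
    (hx : x ∈ ysub R N n kap (IsMatching N) c) : symC R N n kap c x = 0 := by
  suffices ysub R N n kap (IsMatching N) c ≤ LinearMap.ker (symC R N n kap c) from this hx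
  refine Submodule.span_le.2 ?_
  rintro _ ⟨x, h, hh, rfl⟩
  simp only [SetLike.mem_coe, LinearMap.mem_ker, map_sub]
  rw [symC_apply, symC_apply, sub_eq_zero]
  symm
  have hh' : kap ∘ h = kap := funext hh
  refine Finset.sum_equiv (Equiv.mulRight h) ?_ ?_
  · intro g
    simp only [Finset.mem_filter, Finset.mem_univ, true_and, Equiv.coe_mulRight,
      Equiv.Perm.coe_mul]
    constructor
    · intro e
      rw [← Function.comp_assoc, e, hh']
    · intro e
      rw [← Function.comp_assoc] at e
      funext y
      obtain ⟨z, rfl⟩ := h.surjective y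
      have := congrFun e z
      simp only [Function.comp] at this ⊢
      rw [this, hh z]
  · intro g _
    exact actC_mul R N g h c x

theorem kapC_symC
    (hcard : ∀ i : Fin n, (Finset.univ.filter fun x => kap x = i).card = lam i)
    (c : ℕ) (x : SChain R (IsMatching N) c) :
    kapC R N n lam kap c (symC R N n kap c x)
      = ((∏ i, Nat.factorial (lam i) : ℕ) : R) • kapC R N n lam kap c x := by
  rw [symC_apply, map_sum, ← card_young lam kap hcard, Nat.cast_smul_eq_nsmul,
    ← Finset.sum_const]
  refine Finset.sum_congr rfl fun g hg => ?_
  exact kapC_act R N n lam kap g (fun y => congrFun (Finset.mem_filter.1 hg).2 y) c x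

end Final

end MatchPaper

open MatchPaper in
/-- If `λ₁! ⬝ λ₂! ⋯ λ_n!` is a unit in the commutative coefficient ring `R`,
then `H̃_d(M_N; R) ≅ H̃_d(BD_n^λ; R) ⊕ H_d(C̃(M_N; R)^{S_λ})`. -/
theorem splitting_when_factorials_invertible
    (R : Type) [CommRing R] (N n : ℕ) (lam : Fin n → ℕ) (kap : Fin N → Fin n)
    (hcard : ∀ i : Fin n, (Finset.univ.filter fun x => kap x = i).card = lam i)
    (hunit : IsUnit ((∏ i, Nat.factorial (lam i) : ℕ) : R)) (dg : ℕ) :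
    Nonempty (MH R N dg ≃ₗ[R] BDH R lam dg × SubH R N n kap dg) := by
  choose T hT1 hT2 using T_props R N n lam kap hcard hunit
  obtain ⟨u, hu⟩ := hunit
  have hunit : IsUnit ((∏ i, Nat.factorial (lam i) : ℕ) : R) := ⟨u, hu⟩
  let s : ∀ c, SChain R (IsBDGraph lam) c →ₗ[R] SChain R (IsMatching N) c := fun c =>
    ((u⁻¹ : Rˣ) : R) • (symC R N n kap c ∘ₗ T c)
  have hs : ∀ c y, s c y = ((u⁻¹ : Rˣ) : R) • symC R N n kap c (T c y) := fun c y => rfl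
  have hks : ∀ c y, kapC R N n lam kap c (s c y) = y := by
    intro c y
    rw [hs, map_smul, kapC_symC R N n lam kap hcard, hT1, smul_smul, ← hu, Units.inv_mul, one_smul]
  have hsb : ∀ c y, s c (bdry R (rankP n) (IsBDGraph lam) c y)
      = bdry R (rankP N) (IsMatching N) c (s (c + 1) y) := by
    intro c y
    rw [hs, hs, map_smul, ← symC_bdry, ← sub_eq_zero, ← smul_sub, ← map_sub,
      symC_ysub, smul_zero]
    rw [ysub_eq_ker R N n lam kap hcard hunit, LinearMap.mem_ker, map_sub, hT1,
      kapC_bdry R N n lam kap hcard hunit, hT1, sub_self]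
  exact split_homology (bdry R (rankP N) (IsMatching N) (dg + 1))
    (bdry R (rankP N) (IsMatching N) dg) (bdry R (rankP n) (IsBDGraph lam) (dg + 1))
    (bdry R (rankP n) (IsBDGraph lam) dg) (kapC R N n lam kap _) (kapC R N n lam kap _)
    (kapC R N n lam kap _) (s _) (s _) (s _)
    (kapC_bdry R N n lam kap hcard hunit _) (kapC_bdry R N n lam kap hcard hunit _)
    (hsb _) (hsb _) (hks _) (hks _) _ _
    (ysub_eq_ker R N n lam kap hcard hunit _) (ysub_eq_ker R N n lam kap hcard hunit _)
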